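/- Fix a > 0, T₀ > 0 and C ∈ ℝ; write z' = z + 1/a and let β(t,x,y,z) = (a/T₀)·(z', 0, 0, t) on the right Rindler wedge RRW = {z + 1/a > |t|}, with Q(β) > 0 there, u = β/√(Q(β)), A^μ = ∑_ν u^ν∂u^μ/∂x^ν, α = √(Q(β))·A, and α² = −a²/T₀². Define on the RRW the entropy current s^μ(x) = C·Q(β(x))^{−2}·β^μ(x), the entropy density s(x) = η(s(x), u(x)) = C·Q(β(x))^{−3/2}, and the antisymmetric potential ς^{μν}(x) = (s(x)/(2α²))·(β^μ(x)α^ν(x) − β^ν(x)α^μ(x)). Then for every μ, ∑_ν ∂ς^{μν}/∂x^ν = s^μ at every point of the RRW; that is, the entropy current is the divergence of the antisymmetric tensor ς. -/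

import Mathlib

open Real MeasureTheory Filter Topology

noncomputable section

/-- Diagonal of the Minkowski metric diag(1,-1,-1,-1). -/
def ηd : Fin 4 → ℝ := ![1, -1, -1, -1]

/-- Minkowski quadratic form Q(v) = (v⁰)² − (v¹)² − (v²)² − (v³)². -/
def minkQ (v : Fin 4 → ℝ) : ℝ := ∑ μ, ηd μ * v μ * v μ

/-- Minkowski bilinear form η(v,w). -/
def minkB (v w : Fin 4 → ℝ) : ℝ := ∑ μ, ηd μ * v μ * w μ

/-- Covariant (lowered) components v_μ = η_{μν} v^ν. -/
def lo (v : Fin 4 → ℝ) (μ : Fin 4) : ℝ := ηd μ * v μ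

/-- Partial derivative ∂_μ of a scalar function on ℝ⁴. -/
def pd (μ : Fin 4) (f : (Fin 4 → ℝ) → ℝ) (x : Fin 4 → ℝ) : ℝ :=
  fderiv ℝ f x (Pi.single μ 1)

/-- Four-temperature field β(t,x,y,z) = (a/T₀)(z+1/a, 0, 0, t), with x = (t,x,y,z). -/
def betaF (a T₀ : ℝ) (x : Fin 4 → ℝ) : Fin 4 → ℝ :=
  fun μ => (a / T₀) * ![x 3 + 1 / a, 0, 0, x 0] μ

/-- The right Rindler wedge {z + 1/a > |t|}. -/
def RRW (a : ℝ) : Set (Fin 4 → ℝ) := {x | |x 0| < x 3 + 1 / a}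

/-- Flow velocity u = β/√(Q(β)). -/
def uF (a T₀ : ℝ) (x : Fin 4 → ℝ) : Fin 4 → ℝ :=
  fun μ => betaF a T₀ x μ / Real.sqrt (minkQ (betaF a T₀ x))

/-- Four-acceleration A^μ = u^ν ∂_ν u^μ. -/
def accF (a T₀ : ℝ) (x : Fin 4 → ℝ) : Fin 4 → ℝ :=
  fun μ => ∑ ν, uF a T₀ x ν * pd ν (fun y => uF a T₀ y μ) x

/-- Thermal acceleration α = √(Q(β))·A = A/T. -/
def alphaF (a T₀ : ℝ) (x : Fin 4 → ℝ) : Fin 4 → ℝ :=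
  fun μ => Real.sqrt (minkQ (betaF a T₀ x)) * accF a T₀ x μ

/-- Entropy current s^μ = C·Q(β)^{−2}·β^μ on the right Rindler wedge. -/
def entCur (a T₀ C : ℝ) (x : Fin 4 → ℝ) : Fin 4 → ℝ :=
  fun μ => C / (minkQ (betaF a T₀ x)) ^ 2 * betaF a T₀ x μ

/-- Entropy density s = C·Q(β)^{−3/2}. -/
def entDens (a T₀ C : ℝ) (x : Fin 4 → ℝ) : ℝ :=
  C * (minkQ (betaF a T₀ x)) ^ (-(3 : ℝ) / 2)

/-- Antisymmetric entropy potential ς^{μν} = (s/(2α²))(β^μα^ν − β^να^μ),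
with α² = −a²/T₀². -/
def entPot (a T₀ C : ℝ) (x : Fin 4 → ℝ) (μ ν : Fin 4) : ℝ :=
  entDens a T₀ C x / (2 * (-(a ^ 2 / T₀ ^ 2))) *
    (betaF a T₀ x μ * alphaF a T₀ x ν - betaF a T₀ x ν * alphaF a T₀ x μ)

/-- The squared Rindler distance (z + 1/a)² − t². -/
def rindlerSq (a : ℝ) (x : Fin 4 → ℝ) : ℝ := (x 3 + 1 / a) ^ 2 - x 0 ^ 2

lemma rindlerSq_pos {a : ℝ} {x : Fin 4 → ℝ} (hx : x ∈ RRW a) : 0 < rindlerSq a x :=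
  sub_pos.2 (sq_lt_sq.2 (lt_of_lt_of_le hx (le_abs_self _)))

lemma isOpen_RRW (a : ℝ) : IsOpen (RRW a) :=
  isOpen_lt (by fun_prop) (by fun_prop)

lemma hasFDerivAt_coord (μ : Fin 4) (x : Fin 4 → ℝ) :
    HasFDerivAt (fun y : Fin 4 → ℝ => y μ)
      (ContinuousLinearMap.proj (R := ℝ) (φ := fun _ : Fin 4 => ℝ) μ) x :=
  (ContinuousLinearMap.proj (R := ℝ) (φ := fun _ : Fin 4 => ℝ) μ).hasFDerivAt

lemma hasFDerivAt_rindlerSq (a : ℝ) (x : Fin 4 → ℝ) :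
    HasFDerivAt (rindlerSq a)
      ((2 * (x 3 + 1 / a)) • ContinuousLinearMap.proj (R := ℝ) (φ := fun _ : Fin 4 => ℝ) 3
        - (2 * x 0) • ContinuousLinearMap.proj (R := ℝ) (φ := fun _ : Fin 4 => ℝ) 0) x := by
  have h := (((hasFDerivAt_coord 3 x).add_const (1 / a)).pow 2).sub
    ((hasFDerivAt_coord 0 x).pow 2)
  refine h.congr_fderiv ?_
  ext v
  simp only [Nat.add_one_sub_one, pow_one, nsmul_eq_mul, Nat.cast_ofNat]

lemma minkQ_betaF (a T₀ : ℝ) (x : Fin 4 → ℝ) :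
    minkQ (betaF a T₀ x) = (a / T₀) ^ 2 * rindlerSq a x := by
  simp [minkQ, betaF, ηd, rindlerSq, Fin.sum_univ_four]
  ring

lemma sqrt_minkQ_betaF {a T₀ : ℝ} (ha : 0 < a) (hT₀ : 0 < T₀) (x : Fin 4 → ℝ) :
    √(minkQ (betaF a T₀ x)) = a / T₀ * √(rindlerSq a x) := by
  rw [minkQ_betaF, Real.sqrt_mul (by positivity), Real.sqrt_sq (by positivity)]

lemma uF_eq {a T₀ : ℝ} (ha : 0 < a) (hT₀ : 0 < T₀) (x : Fin 4 → ℝ) (μ : Fin 4) :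
    uF a T₀ x μ = ![x 3 + 1 / a, 0, 0, x 0] μ / √(rindlerSq a x) := by
  rw [uF, sqrt_minkQ_betaF ha hT₀, betaF, mul_div_mul_left _ _ (by positivity)]

lemma pd_div_sqrt_rindlerSq {a : ℝ} {x : Fin 4 → ℝ} (hx : x ∈ RRW a)
    {f : (Fin 4 → ℝ) → ℝ} {f' : (Fin 4 → ℝ) →L[ℝ] ℝ} (hf : HasFDerivAt f f' x) (ν : Fin 4) :
    pd ν (fun y => f y / √(rindlerSq a y)) x =
      f' (Pi.single ν 1) / √(rindlerSq a x) -
        f x * ![-x 0, 0, 0, x 3 + 1 / a] ν / (√(rindlerSq a x)) ^ 3 := by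
  have hP := rindlerSq_pos hx
  have hs : √(rindlerSq a x) ≠ 0 := (Real.sqrt_pos.2 hP).ne'
  have h := hf.mul ((hasDerivAt_inv hs).comp_hasFDerivAt x
    ((hasFDerivAt_rindlerSq a x).sqrt hP.ne'))
  have h' : HasFDerivAt (fun y => f y / √(rindlerSq a y)) _ x := h
  rw [pd, h'.fderiv]
  fin_cases ν <;> simp <;> field_simp <;> ring

lemma accF_eq {a T₀ : ℝ} (ha : 0 < a) (hT₀ : 0 < T₀) {x : Fin 4 → ℝ} (hx : x ∈ RRW a)
    (μ : Fin 4) :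
    accF a T₀ x μ = ![x 0, 0, 0, x 3 + 1 / a] μ / rindlerSq a x := by
  have hP := rindlerSq_pos hx
  have hs : √(rindlerSq a x) ≠ 0 := (Real.sqrt_pos.2 hP).ne'
  have hsq := Real.sq_sqrt hP.le
  have ht := pd_div_sqrt_rindlerSq hx (hasFDerivAt_coord 0 x)
  have hz := pd_div_sqrt_rindlerSq hx ((hasFDerivAt_coord 3 x).add_const (1 / a))
  have h0 (ν : Fin 4) : pd ν (fun _ => (0 : ℝ)) x = 0 := by simp [pd]
  simp only [accF, uF_eq ha hT₀, Fin.sum_univ_four]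
  fin_cases μ <;> simp [ht, hz, h0, -one_div] <;> field_simp
  · linear_combination (-(x 0 * a ^ 2 * √(rindlerSq a x) ^ 2)) * hsq
  · linear_combination (-((x 3 * a + 1) * √(rindlerSq a x) ^ 2)) * hsq

lemma entDens_eq {a T₀ : ℝ} (C : ℝ) (ha : 0 < a) (hT₀ : 0 < T₀) {x : Fin 4 → ℝ}
    (hx : x ∈ RRW a) :
    entDens a T₀ C x = C / (a / T₀ * √(rindlerSq a x)) ^ 3 := by
  have hQ : 0 < minkQ (betaF a T₀ x) := by
    have := rindlerSq_pos hx
    rw [minkQ_betaF]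
    positivity
  rw [entDens, ← sqrt_minkQ_betaF ha hT₀, neg_div, Real.rpow_neg hQ.le, ← div_eq_mul_inv,
    Real.sqrt_eq_rpow, ← Real.rpow_natCast, ← Real.rpow_mul hQ.le]
  norm_num

lemma entPot_eq {a T₀ : ℝ} (C : ℝ) (ha : 0 < a) (hT₀ : 0 < T₀) {x : Fin 4 → ℝ}
    (hx : x ∈ RRW a) (μ ν : Fin 4) :
    entPot a T₀ C x μ ν =
      -(C / (2 * (a / T₀) ^ 3)) *
        (![1, 0, 0, 0] μ * ![0, 0, 0, 1] ν - ![1, 0, 0, 0] ν * ![0, 0, 0, 1] μ)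
        * (rindlerSq a x)⁻¹ := by
  have hP := rindlerSq_pos hx
  have hs := Real.sqrt_pos.2 hP
  have hsq := Real.sq_sqrt hP.le
  set r := √(rindlerSq a x)
  have key : ![x 3 + 1 / a, 0, 0, x 0] μ * ![x 0, 0, 0, x 3 + 1 / a] ν
      - ![x 3 + 1 / a, 0, 0, x 0] ν * ![x 0, 0, 0, x 3 + 1 / a] μ
      = (![1, 0, 0, 0] μ * ![0, 0, 0, 1] ν - ![1, 0, 0, 0] ν * ![0, 0, 0, 1] μ) * r ^ 2 := by
    rw [hsq, rindlerSq]
    fin_cases μ <;> fin_cases ν <;> simp <;> ring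
  have expand : entPot a T₀ C x μ ν = C / (a / T₀ * r) ^ 3 / (2 * (-(a ^ 2 / T₀ ^ 2))) *
      ((a / T₀) ^ 2 * r / r ^ 2 * (![x 3 + 1 / a, 0, 0, x 0] μ * ![x 0, 0, 0, x 3 + 1 / a] ν
      - ![x 3 + 1 / a, 0, 0, x 0] ν * ![x 0, 0, 0, x 3 + 1 / a] μ)) := by
    simp only [entPot, entDens_eq C ha hT₀ hx, alphaF, accF_eq ha hT₀ hx,
      sqrt_minkQ_betaF ha hT₀, betaF, hsq]
    ring
  rw [expand, key, ← hsq]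
  field_simp

lemma pd_entPot {a T₀ : ℝ} (C : ℝ) (ha : 0 < a) (hT₀ : 0 < T₀) {x : Fin 4 → ℝ}
    (hx : x ∈ RRW a) (μ ν ρ : Fin 4) :
    pd ρ (fun y => entPot a T₀ C y μ ν) x =
      C / (a / T₀) ^ 3 *
        (![1, 0, 0, 0] μ * ![0, 0, 0, 1] ν - ![1, 0, 0, 0] ν * ![0, 0, 0, 1] μ)
        * ![-x 0, 0, 0, x 3 + 1 / a] ρ / rindlerSq a x ^ 2 := by
  have hP := rindlerSq_pos hx
  have hloc : (fun y => entPot a T₀ C y μ ν) =ᶠ[𝓝 x] fun y =>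
      -(C / (2 * (a / T₀) ^ 3)) *
        (![1, 0, 0, 0] μ * ![0, 0, 0, 1] ν - ![1, 0, 0, 0] ν * ![0, 0, 0, 1] μ)
        * (rindlerSq a y)⁻¹ := by
    filter_upwards [(isOpen_RRW a).mem_nhds hx] with y hy
    exact entPot_eq C ha hT₀ hy μ ν
  have h := (((hasDerivAt_inv hP.ne').comp_hasFDerivAt x (hasFDerivAt_rindlerSq a x)).const_mul
    (-(C / (2 * (a / T₀) ^ 3)) *
      (![1, 0, 0, 0] μ * ![0, 0, 0, 1] ν - ![1, 0, 0, 0] ν * ![0, 0, 0, 1] μ)))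
  have h' := h.congr_of_eventuallyEq hloc
  rw [pd, h'.fderiv]
  generalize (![1, 0, 0, 0] μ * ![0, 0, 0, 1] ν - ![1, 0, 0, 0] ν * ![0, 0, 0, 1] μ : ℝ) = m
  fin_cases ρ <;> simp <;> field_simp

/-- On the right Rindler wedge the entropy density equals η(s,u), and the
entropy current s^μ = C·Q(β)^{−2}·β^μ is the divergence of the antisymmetric
potential ς: ∂_νς^{μν} = s^μ. -/
theorem entropy_current_is_divergence_of_potential
    (a T₀ C : ℝ) (ha : 0 < a) (hT₀ : 0 < T₀) :
    ∀ x ∈ RRW a,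
      entDens a T₀ C x = minkB (entCur a T₀ C x) (uF a T₀ x) ∧
      ∀ μ : Fin 4,
        ∑ ν, pd ν (fun y => entPot a T₀ C y μ ν) x = entCur a T₀ C x μ := by
  intro x hx
  have hP := rindlerSq_pos hx
  have hs := Real.sqrt_pos.2 hP
  have hsq := Real.sq_sqrt hP.le
  refine ⟨?_, fun μ => ?_⟩
  · have hB : minkB (entCur a T₀ C x) (uF a T₀ x) =
        C / minkQ (betaF a T₀ x) ^ 2 * (minkQ (betaF a T₀ x) / √(minkQ (betaF a T₀ x))) := by
      simp only [minkB, entCur, uF, Fin.sum_univ_four]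
      nth_rw 10 [minkQ]
      simp only [Fin.sum_univ_four]
      ring
    rw [hB, entDens_eq C ha hT₀ hx, sqrt_minkQ_betaF ha hT₀, minkQ_betaF, ← hsq]
    rw [Real.sqrt_sq hs.le]
    field_simp
  · simp only [pd_entPot C ha hT₀ hx, Fin.sum_univ_four, entCur, minkQ_betaF, betaF]
    fin_cases μ <;> simp <;> field_simp
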